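/- Let u: X→Y, u': X'→Y', f: X→X', g: Y→Y' be morphisms in T with g∘u = u'∘f, and let X →u Y →v Z →w ΣX and X' →u' Y' →v' Z' →w' ΣX' be distinguished triangles. Then the following are equivalent: (1) there exists k: Y→X' with k∘u = f and u'∘k = g; (2) v'∘g = 0 and (Σf)∘w = 0, and the map of triangles (f, g, 0) is good; (3) v'∘g = 0 and (Σf)∘w = 0, and the map of triangles (0, f, g) from the rotated distinguished triangle Σ⁻¹Z →(−Σ⁻¹w) X →u Y →v Z to the rotated distinguished triangle Σ⁻¹Z' →(−Σ⁻¹w') X' →u' Y' →v' Z' is Verdier good. -/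

import Mathlib

open CategoryTheory Category Limits Pretriangulated

universe v u

variable {C : Type u} [Category.{v} C] [Preadditive C] [HasZeroObject C]
  [HasShift C ℤ] [∀ n : ℤ, (shiftFunctor C n).Additive] [Pretriangulated C]
  [IsTriangulated C] [HasBinaryBiproducts C]

noncomputable local instance (n : ℤ) : PreservesBinaryBiproducts (shiftFunctor C n) :=
  preservesBinaryBiproducts_of_preservesBiproducts _

/-- The condition that `(f, g, h)` is a morphism of triangles from `T` to `T'`. -/
def IsTriMap (T T' : Triangle C) (f : T.obj₁ ⟶ T'.obj₁) (g : T.obj₂ ⟶ T'.obj₂)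
    (h : T.obj₃ ⟶ T'.obj₃) : Prop :=
  T.mor₁ ≫ g = f ≫ T'.mor₁ ∧ T.mor₂ ≫ h = g ≫ T'.mor₂ ∧
    T.mor₃ ≫ f⟦(1 : ℤ)⟧' = h ≫ T'.mor₃

/-- The mapping cone of a morphism of triangles. -/
noncomputable def mappingCone (T T' : Triangle C) (f : T.obj₁ ⟶ T'.obj₁)
    (g : T.obj₂ ⟶ T'.obj₂) (h : T.obj₃ ⟶ T'.obj₃) : Triangle C :=
  Triangle.mk
    (biprod.desc (biprod.lift T'.mor₁ 0) (biprod.lift g (-T.mor₂)) :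
      T'.obj₁ ⊞ T.obj₂ ⟶ T'.obj₂ ⊞ T.obj₃)
    (biprod.desc (biprod.lift T'.mor₂ 0) (biprod.lift h (-T.mor₃)) :
      T'.obj₂ ⊞ T.obj₃ ⟶ T'.obj₃ ⊞ T.obj₁⟦(1 : ℤ)⟧)
    (biprod.desc (biprod.lift T'.mor₃ 0)
        (biprod.lift (f⟦(1 : ℤ)⟧') (-(T.mor₁⟦(1 : ℤ)⟧'))) ≫
      ((shiftFunctor C (1 : ℤ)).mapBiprod T'.obj₁ T.obj₂).inv)

/-- A morphism of triangles is good if its mapping cone is distinguished. -/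
noncomputable def IsGood (T T' : Triangle C) (f : T.obj₁ ⟶ T'.obj₁)
    (g : T.obj₂ ⟶ T'.obj₂) (h : T.obj₃ ⟶ T'.obj₃) : Prop :=
  mappingCone T T' f g h ∈ distTriang C

/-- An octahedron on composable maps `a`, `b`, given distinguished triangles
`(a, p₁, q₁)`, `(b, p₂, q₂)` and `(a ≫ b, p₃, q₃)`, is a pair `(m, n)` as below. -/
def IsOctahedron {A₁ A₂ A₃ B₁ B₂ B₃ : C} (a : A₁ ⟶ A₂) (b : A₂ ⟶ A₃)
    (p₁ : A₂ ⟶ B₁) (q₁ : B₁ ⟶ A₁⟦(1 : ℤ)⟧)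
    (p₂ : A₃ ⟶ B₂) (q₂ : B₂ ⟶ A₂⟦(1 : ℤ)⟧)
    (p₃ : A₃ ⟶ B₃) (q₃ : B₃ ⟶ A₁⟦(1 : ℤ)⟧)
    (m : B₁ ⟶ B₃) (n : B₃ ⟶ B₂) : Prop :=
  p₁ ≫ m = b ≫ p₃ ∧ m ≫ q₃ = q₁ ∧ p₃ ≫ n = p₂ ∧ n ≫ q₂ = q₃ ≫ a⟦(1 : ℤ)⟧' ∧
    (Triangle.mk m n (q₂ ≫ p₁⟦(1 : ℤ)⟧') ∈ distTriang C)

/-- A morphism of triangles `(f, g, h)` is Verdier good if `h` arises from Verdier's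
construction via two octahedra on the composite `g ∘ u = u' ∘ f`. -/
def IsVerdierGood (T T' : Triangle C) (f : T.obj₁ ⟶ T'.obj₁) (g : T.obj₂ ⟶ T'.obj₂)
    (h : T.obj₃ ⟶ T'.obj₃) : Prop :=
  ∃ (A Y'' X'' : C) (vt : T'.obj₂ ⟶ A) (wt : A ⟶ T.obj₁⟦(1 : ℤ)⟧)
    (g' : T'.obj₂ ⟶ Y'') (g'' : Y'' ⟶ T.obj₂⟦(1 : ℤ)⟧)
    (f' : T'.obj₁ ⟶ X'') (f'' : X'' ⟶ T.obj₁⟦(1 : ℤ)⟧)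
    (α₁ : T.obj₃ ⟶ A) (β₁ : A ⟶ Y'') (α₂ : X'' ⟶ A) (β₂ : A ⟶ T'.obj₃),
    (Triangle.mk (T.mor₁ ≫ g) vt wt ∈ distTriang C) ∧
    (Triangle.mk g g' g'' ∈ distTriang C) ∧
    (Triangle.mk f f' f'' ∈ distTriang C) ∧
    IsOctahedron T.mor₁ g T.mor₂ T.mor₃ g' g'' vt wt α₁ β₁ ∧
    IsOctahedron f T'.mor₁ f' f'' T'.mor₂ T'.mor₃ vt wt α₂ β₂ ∧
    h = α₁ ≫ β₂

/-- The morphism of triangles `(f, g, h)` is nullhomotopic, in the (equivalent)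
`Σ`-applied formulation of the first equation. -/
def IsNullHomotopic (T T' : Triangle C) (f : T.obj₁ ⟶ T'.obj₁) (g : T.obj₂ ⟶ T'.obj₂)
    (h : T.obj₃ ⟶ T'.obj₃) : Prop :=
  ∃ (F : T.obj₂ ⟶ T'.obj₁) (G : T.obj₃ ⟶ T'.obj₂) (H : T.obj₁⟦(1 : ℤ)⟧ ⟶ T'.obj₃),
    f⟦(1 : ℤ)⟧' = T.mor₁⟦(1 : ℤ)⟧' ≫ F⟦(1 : ℤ)⟧' + H ≫ T'.mor₃ ∧
    g = T.mor₂ ≫ G + F ≫ T'.mor₁ ∧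
    h = T.mor₃ ≫ H + G ≫ T'.mor₂

/-- A triangle is contractible if its identity morphism is nullhomotopic. -/
def IsContractible (T : Triangle C) : Prop :=
  IsNullHomotopic T T (𝟙 T.obj₁) (𝟙 T.obj₂) (𝟙 T.obj₃)

/-- A morphism of triangles is middling good if it extends to a 4 × 4 diagram. -/
def IsMiddlingGood (T T' : Triangle C) (f : T.obj₁ ⟶ T'.obj₁) (g : T.obj₂ ⟶ T'.obj₂)
    (h : T.obj₃ ⟶ T'.obj₃) : Prop :=
  ∃ (X'' Y'' Z'' : C)
    (f' : T'.obj₁ ⟶ X'') (f'' : X'' ⟶ T.obj₁⟦(1 : ℤ)⟧)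
    (g' : T'.obj₂ ⟶ Y'') (g'' : Y'' ⟶ T.obj₂⟦(1 : ℤ)⟧)
    (h' : T'.obj₃ ⟶ Z'') (h'' : Z'' ⟶ T.obj₃⟦(1 : ℤ)⟧)
    (u'' : X'' ⟶ Y'') (v'' : Y'' ⟶ Z'') (w'' : Z'' ⟶ X''⟦(1 : ℤ)⟧),
    (Triangle.mk f f' f'' ∈ distTriang C) ∧
    (Triangle.mk g g' g'' ∈ distTriang C) ∧
    (Triangle.mk h h' h'' ∈ distTriang C) ∧
    (Triangle.mk u'' v'' w'' ∈ distTriang C) ∧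
    T'.mor₁ ≫ g' = f' ≫ u'' ∧
    T'.mor₂ ≫ h' = g' ≫ v'' ∧
    T'.mor₃ ≫ f'⟦(1 : ℤ)⟧' = h' ≫ w'' ∧
    u'' ≫ g'' = f'' ≫ T.mor₁⟦(1 : ℤ)⟧' ∧
    v'' ≫ h'' = g'' ≫ T.mor₂⟦(1 : ℤ)⟧' ∧
    h'' ≫ T.mor₃⟦(1 : ℤ)⟧' = -(w'' ≫ f''⟦(1 : ℤ)⟧')

/-- A candidate triangle `(a, b, c)` is replaceably exact if each of its three maps
can be replaced to give a distinguished triangle. -/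
def ReplaceablyExact {A B D : C} (a : A ⟶ B) (b : B ⟶ D) (c : D ⟶ A⟦(1 : ℤ)⟧) : Prop :=
  (∃ a' : A ⟶ B, Triangle.mk a' b c ∈ distTriang C) ∧
  (∃ b' : B ⟶ D, Triangle.mk a b' c ∈ distTriang C) ∧
  (∃ c' : D ⟶ A⟦(1 : ℤ)⟧, Triangle.mk a b c' ∈ distTriang C)

set_option linter.unusedSectionVars false

/-- A triangle which is a direct sum of two distinguished triangles is distinguished. -/
lemma distinguished_of_bicone {B T₁ T₂ : Triangle C} (hT₁ : T₁ ∈ distTriang C)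
    (hT₂ : T₂ ∈ distTriang C) (i₁ : T₁ ⟶ B) (i₂ : T₂ ⟶ B) (p₁ : B ⟶ T₁) (p₂ : B ⟶ T₂)
    (h₁₁ : i₁ ≫ p₁ = 𝟙 T₁) (h₁₂ : i₁ ≫ p₂ = 0) (h₂₁ : i₂ ≫ p₁ = 0) (h₂₂ : i₂ ≫ p₂ = 𝟙 T₂)
    (total : p₁ ≫ i₁ + p₂ ≫ i₂ = 𝟙 B) : B ∈ distTriang C := by
  let T : WalkingPair → Triangle C := fun j => WalkingPair.rec T₁ T₂ j
  let πl : productTriangle T ⟶ T₁ := productTriangle.π T .left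
  let πr : productTriangle T ⟶ T₂ := productTriangle.π T .right
  let l : B ⟶ productTriangle T :=
    productTriangle.lift T (fun j => WalkingPair.rec (motive := fun j => B ⟶ T j) p₁ p₂ j)
  have hl : l ≫ πl = p₁ := by
    ext
    exacts [Pi.lift_π _ WalkingPair.left, Pi.lift_π _ WalkingPair.left,
      Pi.lift_π _ WalkingPair.left]
  have hr : l ≫ πr = p₂ := by
    ext
    exacts [Pi.lift_π _ WalkingPair.right, Pi.lift_π _ WalkingPair.right,
      Pi.lift_π _ WalkingPair.right]
  refine isomorphic_distinguished _ (productTriangle_distinguished T ?_) _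
    ⟨l, πl ≫ i₁ + πr ≫ i₂, ?_, ?_⟩
  · rintro (_ | _)
    exacts [hT₁, hT₂]
  · rw [Preadditive.comp_add, reassoc_of% hl, reassoc_of% hr, total]
  · refine (productTriangle.isLimitFan T).hom_ext ?_
    rintro ⟨_ | _⟩
    · change (_ ≫ l) ≫ πl = 𝟙 _ ≫ πl
      simp only [Preadditive.add_comp, assoc, hl, h₁₁, h₂₁, comp_id, comp_zero, add_zero, id_comp]
    · change (_ ≫ l) ≫ πr = 𝟙 _ ≫ πr
      simp only [Preadditive.add_comp, assoc, hr, h₁₂, h₂₂, comp_id, comp_zero, zero_add, id_comp]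

/-- A lift up to an endomorphism `a` fixing the first two maps of a distinguished triangle
can be corrected to a genuine lift, since `𝟙 - a` squares to zero. -/
lemma exists_factorization_of_twisted {X Y : C} {T : Triangle C} (hT : T ∈ distTriang C)
    {u : X ⟶ Y} {f : X ⟶ T.obj₂} {g : Y ⟶ T.obj₃} (a : T.obj₂ ⟶ T.obj₂) (b : Y ⟶ T.obj₂)
    (ha₁ : T.mor₁ ≫ a = T.mor₁) (ha₂ : a ≫ T.mor₂ = T.mor₂)
    (hb₁ : u ≫ b = f ≫ a) (hb₂ : b ≫ T.mor₂ = g) :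
    ∃ k : Y ⟶ T.obj₂, u ≫ k = f ∧ k ≫ T.mor₂ = g := by
  obtain ⟨t, ht⟩ := Triangle.coyoneda_exact₂ T hT (𝟙 _ - a) (by simp [ha₂])
  have hsq : (𝟙 _ - a) ≫ (𝟙 _ - a) = 0 := by
    nth_rw 1 [ht]
    simp [ha₁]
  have hinv : a ≫ (𝟙 _ + (𝟙 _ - a)) = 𝟙 _ := by
    rw [← sub_eq_zero, ← neg_eq_zero, ← hsq]
    simp only [Preadditive.comp_add, Preadditive.comp_sub, Preadditive.sub_comp, comp_id, id_comp]
    abel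
  refine ⟨b ≫ (𝟙 _ + (𝟙 _ - a)), ?_, ?_⟩
  · rw [reassoc_of% hb₁, hinv, comp_id]
  · simp [ha₂, hb₂]

/-- The direct sum of two distinguished triangles is distinguished. -/
lemma biprod_distinguished {X Y Z X' Y' Z' : C} {u : X ⟶ Y} {v : Y ⟶ Z} {w : Z ⟶ X⟦(1 : ℤ)⟧}
    {u' : X' ⟶ Y'} {v' : Y' ⟶ Z'} {w' : Z' ⟶ X'⟦(1 : ℤ)⟧}
    (hT : Triangle.mk u v w ∈ distTriang C) (hT' : Triangle.mk u' v' w' ∈ distTriang C) :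
    Triangle.mk (biprod.map u u') (biprod.map v v')
      (biprod.desc (w ≫ (biprod.inl : X ⟶ X ⊞ X')⟦(1 : ℤ)⟧')
        (w' ≫ (biprod.inr : X' ⟶ X ⊞ X')⟦(1 : ℤ)⟧')) ∈ distTriang C := by
  have fst_comm : biprod.desc (w ≫ (biprod.inl : X ⟶ X ⊞ X')⟦(1 : ℤ)⟧')
      (w' ≫ (biprod.inr : X' ⟶ X ⊞ X')⟦(1 : ℤ)⟧') ≫ biprod.fst⟦(1 : ℤ)⟧' = biprod.fst ≫ w := by
    ext <;> simp [← Functor.map_comp]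
  have snd_comm : biprod.desc (w ≫ (biprod.inl : X ⟶ X ⊞ X')⟦(1 : ℤ)⟧')
      (w' ≫ (biprod.inr : X' ⟶ X ⊞ X')⟦(1 : ℤ)⟧') ≫ biprod.snd⟦(1 : ℤ)⟧' = biprod.snd ≫ w' := by
    ext <;> simp [← Functor.map_comp]
  refine distinguished_of_bicone hT hT'
    { hom₁ := biprod.inl, hom₂ := biprod.inl, hom₃ := biprod.inl
      comm₁ := (biprod.inl_map u u').symm
      comm₂ := (biprod.inl_map v v').symm
      comm₃ := (biprod.inl_desc _ _).symm }
    { hom₁ := biprod.inr, hom₂ := biprod.inr, hom₃ := biprod.inr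
      comm₁ := (biprod.inr_map u u').symm
      comm₂ := (biprod.inr_map v v').symm
      comm₃ := (biprod.inr_desc _ _).symm }
    { hom₁ := biprod.fst, hom₂ := biprod.fst, hom₃ := biprod.fst
      comm₁ := biprod.map_fst u u', comm₂ := biprod.map_fst v v', comm₃ := fst_comm }
    { hom₁ := biprod.snd, hom₂ := biprod.snd, hom₃ := biprod.snd
      comm₁ := biprod.map_snd u u', comm₂ := biprod.map_snd v v', comm₃ := snd_comm }
    ?_ ?_ ?_ ?_ ?_
  · ext
    exacts [biprod.inl_fst, biprod.inl_fst, biprod.inl_fst]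
  · ext
    exacts [biprod.inl_snd, biprod.inl_snd, biprod.inl_snd]
  · ext
    exacts [biprod.inr_fst, biprod.inr_fst, biprod.inr_fst]
  · ext
    exacts [biprod.inr_snd, biprod.inr_snd, biprod.inr_snd]
  · ext
    exacts [biprod.total, biprod.total, biprod.total]

/-- The comparison isomorphism `(X ⊞ Y)⟦1⟧ ≅ X⟦1⟧ ⊞ Y⟦1⟧` in the third map of a mapping cone,
written out in terms of the inclusions. -/
lemma desc_lift_mapBiprod_inv {W W' X Y : C} (a : W ⟶ X⟦(1 : ℤ)⟧) (b : W ⟶ Y⟦(1 : ℤ)⟧)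
    (a' : W' ⟶ X⟦(1 : ℤ)⟧) (b' : W' ⟶ Y⟦(1 : ℤ)⟧) :
    biprod.desc (biprod.lift a b) (biprod.lift a' b') ≫
        ((shiftFunctor C (1 : ℤ)).mapBiprod X Y).inv =
      biprod.desc (a ≫ biprod.inl⟦(1 : ℤ)⟧' + b ≫ biprod.inr⟦(1 : ℤ)⟧')
        (a' ≫ biprod.inl⟦(1 : ℤ)⟧' + b' ≫ biprod.inr⟦(1 : ℤ)⟧') := by
  have key {V : C} (c : V ⟶ X⟦(1 : ℤ)⟧) (d : V ⟶ Y⟦(1 : ℤ)⟧) :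
      biprod.lift c d ≫ ((shiftFunctor C (1 : ℤ)).mapBiprod X Y).inv =
        c ≫ biprod.inl⟦(1 : ℤ)⟧' + d ≫ biprod.inr⟦(1 : ℤ)⟧' := biprod.lift_desc
  ext
  · rw [biprod.inl_desc_assoc, biprod.inl_desc, key]
  · rw [biprod.inr_desc_assoc, biprod.inr_desc, key]

/-- Distinguished triangles are closed under isomorphism, in unbundled form. -/
lemma mk_distinguished_of_iso {X Y Z X' Y' Z' : C}
    {u : X ⟶ Y} {v : Y ⟶ Z} {w : Z ⟶ X⟦(1 : ℤ)⟧}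
    {u' : X' ⟶ Y'} {v' : Y' ⟶ Z'} {w' : Z' ⟶ X'⟦(1 : ℤ)⟧}
    (hT : Triangle.mk u v w ∈ distTriang C) (e₁ : X' ≅ X) (e₂ : Y' ≅ Y) (e₃ : Z' ≅ Z)
    (comm₁ : u' ≫ e₂.hom = e₁.hom ≫ u) (comm₂ : v' ≫ e₃.hom = e₂.hom ≫ v)
    (comm₃ : w' ≫ e₁.hom⟦(1 : ℤ)⟧' = e₃.hom ≫ w) :
    Triangle.mk u' v' w' ∈ distTriang C :=
  isomorphic_distinguished _ hT _ (Triangle.isoMk _ _ e₁ e₂ e₃ comm₁ comm₂ comm₃)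

/-- The shear automorphism of a biproduct. -/
@[simps]
noncomputable def biprodShear {X Y : C} (k : Y ⟶ X) : X ⊞ Y ≅ X ⊞ Y where
  hom := biprod.desc biprod.inl (biprod.lift k (𝟙 Y))
  inv := biprod.desc biprod.inl (biprod.lift (-k) (𝟙 Y))

section

variable {X Y Z X' Y' Z' : C} {u : X ⟶ Y} {v : Y ⟶ Z} {w : Z ⟶ X⟦(1 : ℤ)⟧}
  {u' : X' ⟶ Y'} {v' : Y' ⟶ Z'} {w' : Z' ⟶ X'⟦(1 : ℤ)⟧}

/-- If the square `(f, g)` has a lift `k`, then `(f, g, 0)` is good. -/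
lemma isGood_of_lift (hT : Triangle.mk u v w ∈ distTriang C)
    (hT' : Triangle.mk u' v' w' ∈ distTriang C) (k : Y ⟶ X') :
    IsGood (Triangle.mk u v w) (Triangle.mk u' v' w') (u ≫ k) (k ≫ u') 0 := by
  have hsum := biprod_distinguished hT' (rot_of_distTriang _ hT)
  have comm₁ : biprod.desc (biprod.lift u' 0) (biprod.lift (k ≫ u') (-v)) ≫
      biprod.map (𝟙 Y') (-𝟙 Z) = (biprodShear k).hom ≫ biprod.map u' v := by
    ext <;> simp
  have comm₂ : biprod.desc (biprod.lift v' 0) (biprod.lift 0 (-w)) ≫ 𝟙 _ =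
      biprod.map (𝟙 Y') (-𝟙 Z) ≫ biprod.map v' w := by
    ext <;> simp
  have comm₃ : biprod.desc (w' ≫ (biprod.inl : X' ⟶ X' ⊞ Y)⟦(1 : ℤ)⟧' + 0 ≫ biprod.inr⟦(1 : ℤ)⟧')
      ((u ≫ k)⟦(1 : ℤ)⟧' ≫ biprod.inl⟦(1 : ℤ)⟧' +
        (-(u⟦(1 : ℤ)⟧')) ≫ biprod.inr⟦(1 : ℤ)⟧') ≫ (biprodShear k).hom⟦(1 : ℤ)⟧' =
      𝟙 _ ≫ biprod.desc (w' ≫ biprod.inl⟦(1 : ℤ)⟧') ((-u⟦(1 : ℤ)⟧') ≫ biprod.inr⟦(1 : ℤ)⟧') := by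
    have hk : biprod.lift k (𝟙 Y) = k ≫ biprod.inl + biprod.inr := by ext <;> simp
    ext1
    · simp [← Functor.map_comp]
    · simp [← Functor.map_comp, hk]
  rw [← desc_lift_mapBiprod_inv] at comm₃
  exact mk_distinguished_of_iso hsum (biprodShear k)
    (biprod.mapIso (Iso.refl Y') (-Iso.refl Z)) (Iso.refl (Z' ⊞ X⟦(1 : ℤ)⟧)) comm₁ comm₂ comm₃

/-- If `(f, g, 0)` is good, then the square `(f, g)` has a lift. -/
lemma exists_lift_of_isGood (hT' : Triangle.mk u' v' w' ∈ distTriang C)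
    {f : X ⟶ X'} {g : Y ⟶ Y'} (h : IsGood (Triangle.mk u v w) (Triangle.mk u' v' w') f g 0) :
    ∃ k : Y ⟶ X', u ≫ k = f ∧ k ≫ u' = g := by
  have comm : biprod.desc (biprod.lift v' 0) (biprod.lift 0 (-w)) ≫
      (biprod.fst : Z' ⊞ X⟦(1 : ℤ)⟧ ⟶ _) = (biprod.fst : Y' ⊞ Z ⟶ _) ≫ v' := by
    ext <;> simp
  obtain ⟨φ, hφ₁, hφ₃⟩ : ∃ φ : X' ⊞ Y ⟶ X',
      biprod.desc (biprod.lift u' 0) (biprod.lift g (-v)) ≫ biprod.fst = φ ≫ u' ∧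
      (biprod.desc (biprod.lift w' 0) (biprod.lift (f⟦(1 : ℤ)⟧') (-(u⟦(1 : ℤ)⟧'))) ≫
        ((shiftFunctor C (1 : ℤ)).mapBiprod X' Y).inv) ≫ φ⟦(1 : ℤ)⟧' = biprod.fst ≫ w' :=
    complete_distinguished_triangle_morphism₁ _ _ h hT' _ _ comm
  rw [desc_lift_mapBiprod_inv] at hφ₃
  have h₁ : u' = (biprod.inl ≫ φ) ≫ u' := by simpa using biprod.inl ≫= hφ₁
  have h₂ : g = (biprod.inr ≫ φ) ≫ u' := by simpa using biprod.inr ≫= hφ₁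
  have h₃ : w' ≫ (biprod.inl ≫ φ)⟦(1 : ℤ)⟧' = w' := by
    simpa [← Functor.map_comp] using biprod.inl ≫= hφ₃
  have h₄ : f ≫ biprod.inl ≫ φ = u ≫ biprod.inr ≫ φ := by
    refine (shiftFunctor C (1 : ℤ)).map_injective ?_
    rw [← sub_eq_zero]
    simpa [← Functor.map_comp, sub_eq_add_neg] using biprod.inr ≫= hφ₃
  obtain ⟨ε, hε, ε_naturality⟩ : ∃ ε : X'⟦(1 : ℤ)⟧⟦(-1 : ℤ)⟧ ⟶ X',
      (Triangle.mk u' v' w').invRotate.mor₁ = -w'⟦(-1 : ℤ)⟧' ≫ ε ∧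
      ∀ a : X' ⟶ X', ε ≫ a = a⟦(1 : ℤ)⟧'⟦(-1 : ℤ)⟧' ≫ ε :=
    ⟨_, rfl, fun a =>
      ((shiftFunctorCompIsoId C (1 : ℤ) (-1) (add_neg_cancel _)).hom.naturality a).symm⟩
  have h₅ : (-w'⟦(-1 : ℤ)⟧' ≫ ε) ≫ biprod.inl ≫ φ = -w'⟦(-1 : ℤ)⟧' ≫ ε := by
    rw [Preadditive.neg_comp, assoc, ε_naturality, ← Functor.map_comp_assoc, h₃]
  rw [← hε] at h₅
  exact exists_factorization_of_twisted (inv_rot_of_distTriang _ hT') _ _ h₅ h₁.symm h₄.symm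
    h₂.symm

end

/-- The cone of a zero map `W ⟶ V` is `V ⊞ W⟦1⟧`. -/
lemma zero_distinguished (W V : C) :
    Triangle.mk (0 : W ⟶ V) (biprod.inl : V ⟶ V ⊞ W⟦(1 : ℤ)⟧) biprod.snd ∈ distTriang C := by
  have h : Triangle.mk (biprod.inl : V ⟶ V ⊞ W⟦(1 : ℤ)⟧) biprod.snd
      (-(0 : W ⟶ V)⟦(1 : ℤ)⟧') ∈ distTriang C := by
    rw [Functor.map_zero, neg_zero]
    exact binaryBiproductTriangle_distinguished V (W⟦(1 : ℤ)⟧)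
  exact (rotate_distinguished_triangle _).2 h

/-- The octahedron on a zero map `0 : W ⟶ V` followed by `b : V ⟶ X`, split along the
retraction `biprod.desc (𝟙 X) t` of the cone of `0 : W ⟶ X`. -/
lemma isOctahedron_zero (W : C) {V X Y : C} {b : V ⟶ X} {u : X ⟶ Y} {v : Y ⟶ V⟦(1 : ℤ)⟧}
    (hT : Triangle.mk b u v ∈ distTriang C) (t : W⟦(1 : ℤ)⟧ ⟶ X) :
    IsOctahedron (0 : W ⟶ V) b biprod.inl biprod.snd u v
      (biprod.inl : X ⟶ X ⊞ W⟦(1 : ℤ)⟧) biprod.snd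
      (biprod.desc (b ≫ biprod.inl) (biprod.lift (-t) (𝟙 _))) (biprod.desc u (t ≫ u)) := by
  have hbu : b ≫ u = 0 := comp_distTriang_mor_zero₁₂ _ hT
  have huv : u ≫ v = 0 := comp_distTriang_mor_zero₂₃ _ hT
  refine ⟨by simp, by ext <;> simp, by simp, by ext <;> simp [huv], ?_⟩
  refine mk_distinguished_of_iso
    (biprod_distinguished hT (contractible_distinguished (W⟦(1 : ℤ)⟧)))
    (Iso.refl _) (biprodShear t) ⟨biprod.inl, biprod.fst, by simp, ?_⟩ ?_ ?_ ?_
  · ext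
    simp
  · ext <;> simp
  · ext <;> simp
  · simp

/-- If the square `(f, g)` has a lift `k`, then `(0, f, g)` is Verdier good. -/
lemma isVerdierGood_of_lift {T T' : Triangle C} (hT : T ∈ distTriang C) (hT' : T' ∈ distTriang C)
    {f : T.obj₂ ⟶ T'.obj₂} {g : T.obj₃ ⟶ T'.obj₃} (k : T.obj₃ ⟶ T'.obj₂)
    (hf : T.mor₂ ≫ k = f) (hg : k ≫ T'.mor₂ = g) : IsVerdierGood T T' 0 f g := by
  have hzero : T.mor₁ ≫ f = 0 := by
    rw [← hf, ← assoc, comp_distTriang_mor_zero₁₂ _ hT, zero_comp]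
  obtain ⟨D, f', f'', hD⟩ := distinguished_cocone_triangle f
  have hA := zero_distinguished T.obj₁ T'.obj₂
  let o := Triangulated.someOctahedron hzero hT hD hA
  have hm : T.mor₂ ≫ o.m₁ ≫ biprod.fst = f := by
    rw [reassoc_of% o.comm₁, biprod.inl_fst, comp_id]
  obtain ⟨t, ht⟩ : ∃ t : T.obj₁⟦(1 : ℤ)⟧ ⟶ T'.obj₂, k - o.m₁ ≫ biprod.fst = T.mor₃ ≫ t :=
    Triangle.yoneda_exact₃ T hT (k - o.m₁ ≫ biprod.fst)
      (by rw [Preadditive.comp_sub, hf, hm, sub_self])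
  have hk : o.m₁ ≫ biprod.desc (𝟙 _) t = k := by
    rw [biprod.desc_eq, Preadditive.comp_add, reassoc_of% o.comm₂, ← ht]
    simp
  refine ⟨_, D, _, biprod.inl, biprod.snd, f', f'', biprod.inl, biprod.snd, o.m₁, o.m₃, _, _,
    by rwa [hzero], hD, zero_distinguished _ _,
    ⟨o.comm₁, o.comm₂, o.comm₃, o.comm₄.symm, o.mem⟩, isOctahedron_zero _ hT' t, ?_⟩
  rw [← hg, ← hk, assoc]
  congr 1
  ext <;> simp

/-- If `(0, f, g)` is Verdier good, then the square `(f, g)` has a lift. -/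
lemma exists_lift_of_isVerdierGood {T T' : Triangle C} (hT' : T' ∈ distTriang C)
    {f : T.obj₂ ⟶ T'.obj₂} {g : T.obj₃ ⟶ T'.obj₃} (h : IsVerdierGood T T' 0 f g) :
    ∃ k : T.obj₃ ⟶ T'.obj₂, T.mor₂ ≫ k = f ∧ k ≫ T'.mor₂ = g := by
  obtain ⟨A, Y'', X'', vt, wt, g', g'', p, q, α₁, β₁, α₂, β₂, -, -, hp,
    ⟨h₁, -, -, -, -⟩, ⟨h₂, -, h₃, -, h₄⟩, rfl⟩ := h
  obtain ⟨ρ, hρ⟩ : ∃ ρ : X'' ⟶ T'.obj₁, 𝟙 _ = p ≫ ρ :=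
    Triangle.yoneda_exact₂ _ hp (𝟙 T'.obj₁) zero_comp
  have comm : (T'.mor₃ ≫ p⟦(1 : ℤ)⟧') ≫ ρ⟦(1 : ℤ)⟧' = 𝟙 _ ≫ T'.mor₃ := by
    rw [assoc, ← Functor.map_comp, ← hρ, CategoryTheory.Functor.map_id, comp_id, id_comp]
  obtain ⟨r, hr₁, hr₂⟩ : ∃ r : A ⟶ T'.obj₂, α₂ ≫ r = ρ ≫ T'.mor₁ ∧ β₂ ≫ 𝟙 _ = r ≫ T'.mor₂ :=
    complete_distinguished_triangle_morphism₂ _ _ h₄ hT' ρ (𝟙 _) comm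
  refine exists_factorization_of_twisted hT' (vt ≫ r) (α₁ ≫ r) ?_ ?_ ?_ ?_
  · rw [← reassoc_of% h₂, hr₁, ← reassoc_of% hρ]
  · rw [assoc, ← hr₂, comp_id, h₃]
  · rw [reassoc_of% h₁]
  · rw [assoc, ← hr₂, comp_id]

theorem stmt_17 {X Y Z X' Y' Z' : C}
    (u : X ⟶ Y) (v : Y ⟶ Z) (w : Z ⟶ X⟦(1 : ℤ)⟧)
    (u' : X' ⟶ Y') (v' : Y' ⟶ Z') (w' : Z' ⟶ X'⟦(1 : ℤ)⟧)
    (hT : Triangle.mk u v w ∈ distTriang C)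
    (hT' : Triangle.mk u' v' w' ∈ distTriang C)
    (f : X ⟶ X') (g : Y ⟶ Y') (hcomm : u ≫ g = f ≫ u') :
    ((∃ k : Y ⟶ X', u ≫ k = f ∧ k ≫ u' = g) ↔
      (g ≫ v' = 0 ∧ w ≫ f⟦(1 : ℤ)⟧' = 0 ∧
        IsGood (Triangle.mk u v w) (Triangle.mk u' v' w') f g 0)) ∧
    ((∃ k : Y ⟶ X', u ≫ k = f ∧ k ≫ u' = g) ↔
      (g ≫ v' = 0 ∧ w ≫ f⟦(1 : ℤ)⟧' = 0 ∧
        IsVerdierGood (Triangle.mk u v w).invRotate (Triangle.mk u' v' w').invRotate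
          0 f g)) := by
  have hzero (k : Y ⟶ X') (hk : u ≫ k = f ∧ k ≫ u' = g) :
      g ≫ v' = 0 ∧ w ≫ f⟦(1 : ℤ)⟧' = 0 := by
    obtain ⟨rfl, rfl⟩ := hk
    have h₁ : u' ≫ v' = 0 := comp_distTriang_mor_zero₁₂ _ hT'
    have h₂ : w ≫ u⟦(1 : ℤ)⟧' = 0 := comp_distTriang_mor_zero₃₁ _ hT
    exact ⟨by rw [assoc, h₁, comp_zero],
      by rw [Functor.map_comp, reassoc_of% h₂, zero_comp]⟩
  refine ⟨⟨?_, fun ⟨_, _, h⟩ => exists_lift_of_isGood hT' h⟩, ⟨fun ⟨k, hk⟩ =>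
    ⟨(hzero k hk).1, (hzero k hk).2, isVerdierGood_of_lift
      (inv_rot_of_distTriang _ hT) (inv_rot_of_distTriang _ hT') k hk.1 hk.2⟩,
    fun ⟨_, _, h⟩ => exists_lift_of_isVerdierGood (inv_rot_of_distTriang _ hT') h⟩⟩
  rintro ⟨k, hk⟩
  refine ⟨(hzero k hk).1, (hzero k hk).2, ?_⟩
  obtain ⟨rfl, rfl⟩ := hk
  exact isGood_of_lift hT hT' k
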